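/- arXiv:2403.17943 — 5 statements merged into one kernel-verified Lean document; each statement's English description precedes it below -/
import Mathlib

section
/- Let n ≥ 2 and let φ be a Young function satisfying the doubling condition with constant K_φ < 2^n. Then for every t > 0 the function τ ↦ (τ/φ(τ))^{1/(n−1)} is integrable on (0, t), i.e. ∫₀^t (τ/φ(τ))^{1/(n−1)} dτ < ∞. -/
open MeasureTheory Metric Set Filter

noncomputable section

/-- A Young function: continuous, convex on `[0,∞)`, vanishing at `0`, positive on `(0,∞)`,
and tending to `∞` at `∞`. -/
def IsYoung (φ : ℝ → ℝ) : Prop :=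
  ContinuousOn φ (Ici 0) ∧ ConvexOn ℝ (Ici 0) φ ∧ φ 0 = 0 ∧
    (∀ t > 0, 0 < φ t) ∧ Tendsto φ atTop atTop

namespace IsYoung

variable {φ : ℝ → ℝ}

lemma nonneg (hφ : IsYoung φ) {x : ℝ} (hx : 0 ≤ x) : 0 ≤ φ x := by
  rcases hx.eq_or_lt with rfl | h
  · exact hφ.2.2.1.ge
  · exact (hφ.2.2.2.1 x h).le

/-- By convexity and `φ 0 = 0`, a Young function satisfies `φ (a x) ≤ a φ x` for `a ∈ [0,1]`. -/
lemma map_mul_le (hφ : IsYoung φ) {a x : ℝ} (ha : 0 ≤ a) (ha1 : a ≤ 1) (hx : 0 ≤ x) :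
    φ (a * x) ≤ a * φ x := by
  have h := hφ.2.1.2 (mem_Ici.2 hx) (mem_Ici.2 le_rfl) ha (sub_nonneg.2 ha1) (by ring)
  simpa [hφ.2.2.1] using h

lemma mono (hφ : IsYoung φ) {x y : ℝ} (hx : 0 ≤ x) (hxy : x ≤ y) : φ x ≤ φ y := by
  rcases hx.eq_or_lt with rfl | h
  · exact hφ.2.2.1.trans_le (hφ.nonneg hxy)
  · have hy : 0 < y := h.trans_le hxy
    have ha1 : x / y ≤ 1 := (div_le_one hy).2 hxy
    have key := hφ.map_mul_le (div_nonneg hx hy.le) ha1 hy.le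
    rw [div_mul_cancel₀ x hy.ne'] at key
    exact key.trans (mul_le_of_le_one_left (hφ.nonneg hy.le) ha1)

lemma two_le_of_doubling (hφ : IsYoung φ) {K : ℝ} (hdbl : ∀ t > 0, φ (2 * t) ≤ K * φ t) :
    2 ≤ K := by
  have h1 := hφ.map_mul_le (a := 1 / 2) (x := 2) (by norm_num) (by norm_num) (by norm_num)
  have h2 := hdbl 1 one_pos
  norm_num at h1 h2
  have h3 := hφ.2.2.2.1 1 one_pos
  exact le_of_mul_le_mul_right (by linarith) h3

/-- A doubling Young function is bounded below by a power with exponent `logb 2 K`. -/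
lemma le_rpow_mul (hφ : IsYoung φ) {K : ℝ} (hdbl : ∀ t > 0, φ (2 * t) ≤ K * φ t)
    {x t : ℝ} (hx : 0 < x) (hxt : x ≤ t) :
    φ t ≤ K * (t / x) ^ Real.logb 2 K * φ x := by
  have hK2 := hφ.two_le_of_doubling hdbl
  have hK0 : 0 < K := by linarith
  obtain ⟨k, hk, hk'⟩ := exists_nat_pow_near ((one_le_div hx).2 hxt) (one_lt_two (α := ℝ))
  have hiter : ∀ m : ℕ, φ (2 ^ m * x) ≤ K ^ m * φ x := by
    intro m
    induction m with
    | zero => simp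
    | succ m ih =>
      calc φ (2 ^ (m + 1) * x) = φ (2 * (2 ^ m * x)) := by ring_nf
        _ ≤ K * φ (2 ^ m * x) := hdbl _ (by positivity)
        _ ≤ K * (K ^ m * φ x) := by gcongr
        _ = K ^ (m + 1) * φ x := by ring
  have hpow : K ^ k ≤ (t / x) ^ Real.logb 2 K := by
    calc K ^ k = ((2 : ℝ) ^ Real.logb 2 K) ^ k := by
          rw [Real.rpow_logb two_pos (by norm_num) hK0]
      _ = ((2 : ℝ) ^ k) ^ Real.logb 2 K := Real.rpow_pow_comm two_pos.le _ _
      _ ≤ (t / x) ^ Real.logb 2 K :=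
          Real.rpow_le_rpow (by positivity) hk (Real.logb_nonneg one_lt_two (by linarith))
  calc φ t ≤ φ (2 ^ (k + 1) * x) := hφ.mono (hx.le.trans hxt) ((div_lt_iff₀ hx).1 hk').le
    _ ≤ K ^ (k + 1) * φ x := hiter _
    _ = K * K ^ k * φ x := by ring
    _ ≤ K * (t / x) ^ Real.logb 2 K * φ x := by
        have := hφ.nonneg hx.le
        gcongr

end IsYoung

/-- If `n ≥ 2` and `φ` is a Young function with doubling constant
`K < 2ⁿ`, then `τ ↦ (τ/φ(τ))^{1/(n-1)}` is integrable on `(0, t)` for every `t > 0`. -/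
theorem statement3 (n : ℕ) (hn : 2 ≤ n) (φ : ℝ → ℝ) (hφ : IsYoung φ)
    (K : ℝ) (hdbl : ∀ t > 0, φ (2 * t) ≤ K * φ t) (hK : K < 2 ^ n) :
    ∀ t > 0, IntegrableOn (fun τ : ℝ => (τ / φ τ) ^ ((1:ℝ) / ((n:ℝ) - 1))) (Ioo 0 t) volume := by
  intro t ht
  have hK2 := hφ.two_le_of_doubling hdbl
  have hK0 : 0 < K := by linarith
  have hn1 : (0 : ℝ) < (n : ℝ) - 1 := by
    have : (2 : ℝ) ≤ n := by exact_mod_cast hn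
    linarith
  set q : ℝ := 1 / ((n : ℝ) - 1) with hq
  have hq0 : 0 < q := by positivity
  set p := Real.logb 2 K with hp
  have hpn : p < n := by
    rw [hp, Real.logb_lt_iff_lt_rpow one_lt_two hK0, Real.rpow_natCast]
    exact hK
  have hexp : -1 < (1 - p) * q := by
    rw [hq, mul_one_div, lt_div_iff₀ hn1]
    linarith
  have hφt : 0 < φ t := hφ.2.2.2.1 t ht
  set C : ℝ := K * t ^ p / φ t with hC
  have hC0 : 0 < C := by positivity
  have hint : IntegrableOn (fun τ : ℝ => C ^ q * τ ^ ((1 - p) * q)) (Ioo 0 t) volume :=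
    ((intervalIntegral.integrableOn_Ioo_rpow_iff ht).2 hexp).const_mul _
  refine Integrable.mono' hint ?_ ?_
  · refine ContinuousOn.aestronglyMeasurable ?_ measurableSet_Ioo
    refine ContinuousOn.rpow_const ?_ fun _ _ => Or.inr hq0.le
    exact continuousOn_id.div (hφ.1.mono fun x hx => hx.1.le)
      fun x hx => (hφ.2.2.2.1 x hx.1).ne'
  · refine (ae_restrict_iff' measurableSet_Ioo).2 (Eventually.of_forall fun x hx => ?_)
    have hx0 : 0 < x := hx.1
    have hφx : 0 < φ x := hφ.2.2.2.1 x hx0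
    have hxp : 0 < x ^ p := Real.rpow_pos_of_pos hx0 p
    have hbound : x / φ x ≤ C * x ^ (1 - p) := by
      have h := hφ.le_rpow_mul hdbl hx0 hx.2.le
      rw [← hp, Real.div_rpow ht.le hx0.le, mul_div_assoc', div_mul_eq_mul_div,
        le_div_iff₀ hxp] at h
      rw [Real.rpow_sub hx0, Real.rpow_one, hC, div_mul_div_comm,
        div_le_div_iff₀ hφx (by positivity)]
      nlinarith [mul_le_mul_of_nonneg_left h hx0.le]
    rw [Real.norm_of_nonneg (by positivity), Real.rpow_mul hx0.le,
      ← Real.mul_rpow hC0.le (by positivity)]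
    exact Real.rpow_le_rpow (by positivity) hbound hq0.le
end
end

section
/- Let n ≥ 2 and let φ be a Young function satisfying the doubling condition with constant K_φ < 2^n. Set q := K_φ^{1/(n−1)} / 2^{n/(n−1)}, so 0 < q < 1. Then for every t > 0, ∫₀^t (τ/φ(τ))^{1/(n−1)} dτ ≤ (1 − q)^{−1} ∫_{t/2}^t (τ/φ(τ))^{1/(n−1)} dτ. -/
open MeasureTheory Metric Set Filter

noncomputable section

/-- If `f (s / 2) ≤ 2 * q * f s` on `(0, t]` with `q < 1`, then the integral of `f ≥ 0` over `(0, t]`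
is controlled by the integral over the upper half `(t / 2, t]`. -/
theorem setIntegral_Ioc_le_of_half_le {f : ℝ → ℝ} {q t : ℝ} (hq : q < 1) (ht : 0 < t)
    (hf : ∀ s ∈ Ioc 0 t, 0 ≤ f s) (hhalf : ∀ s ∈ Ioc 0 t, f (s / 2) ≤ 2 * q * f s) :
    ∫ s in Ioc 0 t, f s ≤ (1 - q)⁻¹ * ∫ s in Ioc (t / 2) t, f s := by
  have hq' : 0 < 1 - q := sub_pos.2 hq
  by_cases hint : IntegrableOn f (Ioc 0 t)
  · have hI : IntervalIntegrable f volume 0 t :=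
      (intervalIntegrable_iff_integrableOn_Ioc_of_le ht.le).2 hint
    have hlow : IntervalIntegrable f volume 0 (t / 2) :=
      (intervalIntegrable_iff_integrableOn_Ioc_of_le (by linarith)).2
        (hint.mono_set (Ioc_subset_Ioc_right (by linarith)))
    have hupp : IntervalIntegrable f volume (t / 2) t :=
      (intervalIntegrable_iff_integrableOn_Ioc_of_le (by linarith)).2
        (hint.mono_set (Ioc_subset_Ioc_left (by linarith)))
    have hscaled : IntervalIntegrable (fun s => f (s / 2)) volume 0 t := by
      have h := hlow.comp_mul_right (c := (2 : ℝ)⁻¹)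
      simpa [div_eq_mul_inv] using h
    have hle : ∫ s in (0 : ℝ)..t, f (s / 2) ≤ ∫ s in (0 : ℝ)..t, 2 * q * f s := by
      refine intervalIntegral.integral_mono_on_of_le_Ioo ht.le hscaled (hI.const_mul _) ?_
      exact fun s hs => hhalf s (Ioo_subset_Ioc_self hs)
    rw [intervalIntegral.integral_comp_div f two_ne_zero, intervalIntegral.integral_const_mul,
      zero_div, smul_eq_mul] at hle
    have hsplit := intervalIntegral.integral_add_adjacent_intervals hlow hupp
    rw [← intervalIntegral.integral_of_le ht.le,
      ← intervalIntegral.integral_of_le (by linarith : t / 2 ≤ t), inv_mul_eq_div,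
      le_div_iff₀ hq']
    linarith
  · rw [integral_undef hint]
    refine mul_nonneg (inv_nonneg.2 hq'.le) (setIntegral_nonneg measurableSet_Ioc ?_)
    exact fun s hs => hf s ⟨by linarith [hs.1], hs.2⟩

/-- With `q := K^{1/(n-1)} / 2^{n/(n-1)}` one has `0 < q < 1`, and for every
`t > 0`, `∫₀ᵗ (τ/φ(τ))^{1/(n-1)} dτ ≤ (1-q)⁻¹ ∫_{t/2}^{t} (τ/φ(τ))^{1/(n-1)} dτ`. -/
theorem statement4 (n : ℕ) (hn : 2 ≤ n) (φ : ℝ → ℝ) (hφ : IsYoung φ)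
    (K : ℝ) (hdbl : ∀ t > 0, φ (2 * t) ≤ K * φ t) (hK : K < 2 ^ n)
    (q : ℝ) (hq : q = K ^ ((1:ℝ) / ((n:ℝ) - 1)) / (2:ℝ) ^ ((n:ℝ) / ((n:ℝ) - 1))) :
    (0 < q ∧ q < 1) ∧
      ∀ t > 0,
        ∫ τ in Ioc (0:ℝ) t, (τ / φ τ) ^ ((1:ℝ) / ((n:ℝ) - 1)) ≤
          (1 - q)⁻¹ * ∫ τ in Ioc (t/2) t, (τ / φ τ) ^ ((1:ℝ) / ((n:ℝ) - 1)) := by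
  obtain ⟨-, -, -, hpos, -⟩ := hφ
  have hn1 : (0 : ℝ) < n - 1 := by
    have : (2 : ℝ) ≤ n := by exact_mod_cast hn
    linarith
  have hK0 : 0 < K :=
    pos_of_mul_pos_left ((hpos (2 * 1) (by norm_num)).trans_le (hdbl 1 one_pos))
      (hpos 1 one_pos).le
  have hq0 : 0 < q := by rw [hq]; positivity
  have hq1 : q < 1 := by
    rw [hq, div_lt_one (by positivity), div_eq_mul_one_div (n : ℝ), Real.rpow_mul two_pos.le,
      Real.rpow_natCast]
    exact Real.rpow_lt_rpow hK0.le hK (by positivity)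
  have hqK : 2 * q = (K / 2) ^ ((1:ℝ) / ((n:ℝ) - 1)) := by
    have he : (n : ℝ) / (n - 1) = 1 + 1 / (n - 1) := by field_simp; ring
    rw [hq, he, Real.rpow_add two_pos, Real.rpow_one, Real.div_rpow hK0.le two_pos.le]
    field_simp
  refine ⟨⟨hq0, hq1⟩, fun t ht => setIntegral_Ioc_le_of_half_le hq1 ht ?_ ?_⟩
  · intro s hs
    exact Real.rpow_nonneg (div_nonneg hs.1.le (hpos s hs.1).le) _
  · intro s hs
    have hs0 : 0 < s := hs.1
    have hφs := hpos s hs0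
    have hφh := hpos (s / 2) (half_pos hs0)
    have hd : φ s ≤ K * φ (s / 2) := by
      simpa [mul_div_cancel₀] using hdbl (s / 2) (half_pos hs0)
    rw [hqK, ← Real.mul_rpow (by positivity) (by positivity)]
    refine Real.rpow_le_rpow (by positivity) ?_ (by positivity)
    rw [div_mul_div_comm, div_div, div_le_div_iff₀ (by positivity) (by positivity)]
    nlinarith [mul_le_mul_of_nonneg_left hd hs0.le]
end
end

section
/- Let n ≥ 2 and let φ be a Young function satisfying the doubling condition with constant K_φ < 2^n. Let H(t) := (∫₀^t (τ/φ(τ))^{1/(n−1)} dτ)^{(n−1)/n}, let g : [0,∞) → [0,∞) be the inverse of H, and set φ_n := φ ∘ g. Then φ_n satisfies the ∇₂-condition with constant a = 2^{n−1} > 1: φ_n(y) ≤ (1/2^n) φ_n(2^{n−1} y) for all y ≥ 0. -/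
open MeasureTheory Metric Set Filter

noncomputable section

/-- `H(t) = (∫₀ᵗ (τ/φ(τ))^{1/(n-1)} dτ)^{(n-1)/n}`. -/
def Hfun (n : ℕ) (φ : ℝ → ℝ) (t : ℝ) : ℝ :=
  (∫ τ in Ioc (0:ℝ) t, (τ / φ τ) ^ ((1:ℝ) / ((n:ℝ) - 1))) ^ (((n:ℝ) - 1) / (n:ℝ))

/-- A Young function satisfies `c φ(t) ≤ φ(c t)` for `c ≥ 1`. -/
theorem IsYoung.mul_le_map_mul {φ : ℝ → ℝ} (hφ : IsYoung φ) {c t : ℝ} (hc : 1 ≤ c)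
    (ht : 0 ≤ t) : c * φ t ≤ φ (c * t) := by
  obtain ⟨-, hconv, h0, -, -⟩ := hφ
  have hc0 : 0 < c := by linarith
  have h := hconv.2 (self_mem_Ici (a := (0 : ℝ))) (mem_Ici.2 (mul_nonneg hc0.le ht))
    (sub_nonneg.2 (inv_le_one_of_one_le₀ hc)) (inv_nonneg.2 hc0.le) (sub_add_cancel 1 c⁻¹)
  simp only [smul_eq_mul, mul_zero, zero_add, h0, inv_mul_cancel_left₀ hc0.ne'] at h
  calc c * φ t ≤ c * (c⁻¹ * φ (c * t)) := by gcongr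
    _ = φ (c * t) := mul_inv_cancel_left₀ hc0.ne' _

theorem IsYoung.nonneg_s7 {φ : ℝ → ℝ} (hφ : IsYoung φ) {t : ℝ} (ht : 0 ≤ t) : 0 ≤ φ t := by
  rcases ht.eq_or_lt with rfl | ht
  · exact hφ.2.2.1.ge
  · exact (hφ.2.2.2.1 t ht).le

theorem IsYoung.le_map_of_le {φ : ℝ → ℝ} (hφ : IsYoung φ) {s t : ℝ} (ht : 0 < t)
    (hts : t ≤ s) : φ t ≤ φ s := by
  have h := hφ.mul_le_map_mul ((one_le_div ht).2 hts) ht.le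
  rw [div_mul_cancel₀ _ ht.ne'] at h
  exact (le_mul_of_one_le_left (hφ.nonneg_s7 ht.le) ((one_le_div ht).2 hts)).trans h

/-- The quotient `τ / φ(τ)` does not increase when `τ` is multiplied by `c ≥ 1`. -/
theorem IsYoung.mul_div_map_mul_le {φ : ℝ → ℝ} (hφ : IsYoung φ) {c t : ℝ} (hc : 1 ≤ c)
    (ht : 0 < t) : c * t / φ (c * t) ≤ t / φ t := by
  have hc0 : 0 < c := by linarith
  rw [div_le_div_iff₀ (hφ.2.2.2.1 _ (by positivity)) (hφ.2.2.2.1 _ ht)]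
  nlinarith [hφ.mul_le_map_mul hc ht.le]

/-- If `f (c x) ≤ f x` on `(0,∞)`, then `∫₀^{ct} f ≤ c ∫₀ᵗ f`. -/
theorem setIntegral_Ioc_mul_le {f : ℝ → ℝ} {c t : ℝ} (hc : 0 < c) (ht : 0 ≤ t)
    (hf : ∀ x > 0, f (c * x) ≤ f x) (hit : IntegrableOn f (Ioc 0 t))
    (hict : IntegrableOn f (Ioc 0 (c * t))) :
    ∫ x in Ioc 0 (c * t), f x ≤ c * ∫ x in Ioc 0 t, f x := by
  have hint : IntervalIntegrable (fun x => f (c * x)) volume 0 t := by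
    have h := ((intervalIntegrable_iff_integrableOn_Ioc_of_le (by positivity)).2
      hict).comp_mul_left (c := c)
    simpa [mul_div_cancel_left₀ _ hc.ne'] using h
  have hscale := intervalIntegral.mul_integral_comp_mul_left (a := 0) (b := t) (f := f) c
  rw [mul_zero] at hscale
  rw [← intervalIntegral.integral_of_le (by positivity), ← intervalIntegral.integral_of_le ht,
    ← hscale]
  gcongr
  exact intervalIntegral.integral_mono_on_of_le_Ioo ht hint
    ((intervalIntegrable_iff_integrableOn_Ioc_of_le ht).2 hit) fun x hx => hf x hx.1

theorem Hfun_of_nonpos {n : ℕ} (hn : 2 ≤ n) (φ : ℝ → ℝ) {t : ℝ} (ht : t ≤ 0) :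
    Hfun n φ t = 0 := by
  have hn' : (2 : ℝ) ≤ n := by exact_mod_cast hn
  have hp : 0 < ((n : ℝ) - 1) / n := div_pos (by linarith) (by linarith)
  rw [Hfun, Ioc_eq_empty (by simpa using ht), setIntegral_empty, Real.zero_rpow hp.ne']

/-- With `g = H⁻¹` and `φ_n := φ ∘ g`, the function `φ_n` satisfies the
`∇₂`-condition with constant `a = 2^{n-1}`: `φ_n(y) ≤ (1/2ⁿ) φ_n(2^{n-1} y)` for all `y ≥ 0`. -/
theorem statement7 (n : ℕ) (hn : 2 ≤ n) (φ : ℝ → ℝ) (hφ : IsYoung φ)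
    (K : ℝ) (hdbl : ∀ t > 0, φ (2 * t) ≤ K * φ t) (hK : K < 2 ^ n)
    (g : ℝ → ℝ) (hg1 : ∀ t ≥ 0, g (Hfun n φ t) = t) (hg2 : ∀ y ≥ 0, Hfun n φ (g y) = y) :
    ∀ y ≥ 0, φ (g y) ≤ (1 / 2 ^ n) * φ (g ((2:ℝ) ^ (n - 1) * y)) := by
  have hn' : (2 : ℝ) ≤ n := by exact_mod_cast hn
  have hn0 : (n : ℝ) ≠ 0 := by positivity
  have hp : 0 < ((n : ℝ) - 1) / n := div_pos (by linarith) (by linarith)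
  have hq : 0 ≤ (1 : ℝ) / ((n : ℝ) - 1) := div_nonneg zero_le_one (by linarith)
  have hH0 : ∀ t ≤ 0, Hfun n φ t = 0 := fun t => Hfun_of_nonpos hn φ
  have hg0 : g 0 = 0 := by simpa [hH0 0 le_rfl] using hg1 0 le_rfl
  have hpos : ∀ y > 0, 0 < g y := by
    intro y hy
    by_contra! h
    exact hy.ne ((hH0 _ h).symm.trans (hg2 y hy.le))
  have hc : (1 : ℝ) ≤ 2 ^ n := one_le_pow₀ one_le_two
  have hc1 : (0 : ℝ) < 2 ^ (n - 1) := by positivity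
  intro y hy
  rcases hy.eq_or_lt with rfl | hy
  · simp [hg0, hφ.2.2.1]
  set f : ℝ → ℝ := fun τ => (τ / φ τ) ^ ((1 : ℝ) / ((n : ℝ) - 1)) with hf
  have hf0 : ∀ x > 0, 0 ≤ f x := fun x hx =>
    Real.rpow_nonneg (div_nonneg hx.le (hφ.nonneg_s7 hx.le)) _
  have hfi : ∀ t > 0, IntegrableOn f (Ioc 0 t) := by
    intro t ht
    by_contra h
    have hHt : Hfun n φ t = 0 := by
      rw [Hfun, integral_undef h, Real.zero_rpow hp.ne']
    have := hg1 t ht.le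
    rw [hHt, hg0] at this
    exact ht.ne this
  have hF0 : ∀ t, 0 ≤ ∫ x in Ioc 0 t, f x := fun t =>
    setIntegral_nonneg measurableSet_Ioc fun x hx => hf0 x hx.1
  set t := g y
  set s := g (2 ^ (n - 1) * y)
  have ht : 0 < t := hpos y hy
  have hs : 0 < s := hpos _ (by positivity)
  have hct : 0 < 2 ^ n * t := by positivity
  have hle : Hfun n φ (2 ^ n * t) ≤ Hfun n φ s := by
    have hpow : ((2 : ℝ) ^ n) ^ (((n : ℝ) - 1) / n) = 2 ^ (n - 1) := by
      rw [← Real.rpow_natCast, ← Real.rpow_natCast, ← Real.rpow_mul zero_le_two,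
        mul_div_cancel₀ _ hn0, Nat.cast_sub (by omega), Nat.cast_one]
    calc Hfun n φ (2 ^ n * t)
        ≤ (2 ^ n * ∫ x in Ioc 0 t, f x) ^ (((n : ℝ) - 1) / n) := by
          refine Real.rpow_le_rpow (hF0 _) (setIntegral_Ioc_mul_le (by positivity) ht.le
            (fun x hx => ?_) (hfi t ht) (hfi _ hct)) hp.le
          exact Real.rpow_le_rpow (div_nonneg (by positivity) (hφ.nonneg_s7 (by positivity)))
            (hφ.mul_div_map_mul_le hc hx) hq
      _ = 2 ^ (n - 1) * Hfun n φ t := by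
          rw [Real.mul_rpow (by positivity) (hF0 _), hpow, Hfun]
      _ = Hfun n φ s := by rw [hg2 y hy.le, hg2 _ (by positivity)]
  have hts : 2 ^ n * t ≤ s := by
    by_contra! h
    have hge : Hfun n φ s ≤ Hfun n φ (2 ^ n * t) := by
      refine Real.rpow_le_rpow (hF0 _) (setIntegral_mono_set (hfi _ hct) ?_
        (Ioc_subset_Ioc_right h.le).eventuallyLE) hp.le
      exact (ae_restrict_mem measurableSet_Ioc).mono fun x hx => hf0 x hx.1
    refine h.ne ?_
    rw [← hg1 s hs.le, ← hg1 _ hct.le, le_antisymm hle hge]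
  rw [one_div, ← div_eq_inv_mul, le_div_iff₀' (by positivity)]
  exact (hφ.mul_le_map_mul hc ht.le).trans (hφ.le_map_of_le hct hts)
end
end

section
/- Let n ≥ 2 and let φ be a Young function satisfying the doubling condition with constant K_φ < 2^n. Then for every t ≥ 0, H(2t) ≥ 2 K_φ^{−1/n} H(t), where H(t) := (∫₀^t (τ/φ(τ))^{1/(n−1)} dτ)^{(n−1)/n}. -/
open MeasureTheory Metric Set Filter

noncomputable section

/-- A Young function satisfies `2 φ(s) ≤ φ(2s)`. -/
lemma IsYoung.two_mul_le {φ : ℝ → ℝ} (hφ : IsYoung φ) {s : ℝ} (hs : 0 < s) :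
    2 * φ s ≤ φ (2 * s) := by
  obtain ⟨-, hconv, h0, -, -⟩ := hφ
  have h := hconv.2 (mem_Ici.2 le_rfl) (mem_Ici.2 (by positivity : 0 ≤ 2 * s))
    (by norm_num : (0 : ℝ) ≤ 1 / 2) (by norm_num : (0 : ℝ) ≤ 1 / 2) (by norm_num)
  have e : (1 / 2 : ℝ) • (0 : ℝ) + (1 / 2 : ℝ) • (2 * s) = s := by
    simp only [smul_eq_mul]; ring
  rw [e, h0] at h
  simp only [smul_eq_mul] at h
  linarith

/-- A doubling constant of a Young function is positive. -/
lemma IsYoung.doubling_pos {φ : ℝ → ℝ} (hφ : IsYoung φ) {K : ℝ}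
    (hdbl : ∀ t > 0, φ (2 * t) ≤ K * φ t) : 0 < K := by
  have h1 := hφ.2.2.2.1 1 one_pos
  have h2 := hφ.2.2.2.1 (2 * 1) (by norm_num)
  exact pos_of_mul_pos_left (h2.trans_le (hdbl 1 one_pos)) h1.le

lemma IsYoung.continuousOn_div_rpow {φ : ℝ → ℝ} (hφ : IsYoung φ) {a : ℝ} (ha : 0 ≤ a) :
    ContinuousOn (fun τ => (τ / φ τ) ^ a) (Ioi 0) :=
  (continuousOn_id.div (hφ.1.mono Ioi_subset_Ici_self)
    fun x hx => (hφ.2.2.2.1 x hx).ne').rpow_const fun _ _ => Or.inr ha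

lemma IsYoung.integrableOn_comp_two_mul {φ : ℝ → ℝ} (hφ : IsYoung φ) {a t : ℝ} (ha : 0 ≤ a)
    (hint : IntegrableOn (fun τ => (τ / φ τ) ^ a) (Ioc 0 t)) :
    IntegrableOn (fun s => (2 * s / φ (2 * s)) ^ a) (Ioc 0 t) := by
  have hcont : ContinuousOn (fun s : ℝ => (2 * s / φ (2 * s)) ^ a) (Ioi 0) :=
    (hφ.continuousOn_div_rpow ha).comp (f := fun s : ℝ => 2 * s) (by fun_prop)
      fun x hx => mem_Ioi.2 (mul_pos two_pos hx)
  refine Integrable.mono' hint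
    ((hcont.mono Ioc_subset_Ioi_self).aestronglyMeasurable measurableSet_Ioc) ?_
  refine (ae_restrict_iff' measurableSet_Ioc).2 (Eventually.of_forall fun s hs => ?_)
  have hs0 : 0 < s := hs.1
  have hp := hφ.2.2.2.1 s hs0
  have hp2 := hφ.2.2.2.1 (2 * s) (by positivity)
  rw [Real.norm_of_nonneg (by positivity)]
  refine Real.rpow_le_rpow (by positivity) ?_ ha
  rw [div_le_div_iff₀ hp2 hp]
  nlinarith [hφ.two_mul_le hs0]

/-- The integral defining `H` grows at least by the factor `2 (2 / K) ^ a` under doubling. -/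
lemma IsYoung.integral_doubling {φ : ℝ → ℝ} (hφ : IsYoung φ) {K a t : ℝ} (ha : 0 ≤ a)
    (ht : 0 ≤ t) (hdbl : ∀ t > 0, φ (2 * t) ≤ K * φ t)
    (hint : IntegrableOn (fun τ => (τ / φ τ) ^ a) (Ioc 0 t)) :
    2 * (2 / K) ^ a * ∫ τ in Ioc (0 : ℝ) t, (τ / φ τ) ^ a ≤
      ∫ τ in Ioc (0 : ℝ) (2 * t), (τ / φ τ) ^ a := by
  have hK := hφ.doubling_pos hdbl
  have hsub : ∫ τ in Ioc (0 : ℝ) (2 * t), (τ / φ τ) ^ a =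
      2 * ∫ s in Ioc (0 : ℝ) t, (2 * s / φ (2 * s)) ^ a := by
    rw [← intervalIntegral.integral_of_le ht,
      ← intervalIntegral.integral_of_le (by positivity : (0 : ℝ) ≤ 2 * t),
      intervalIntegral.integral_comp_mul_left (fun τ => (τ / φ τ) ^ a) two_ne_zero]
    simp
  rw [hsub, mul_assoc, ← integral_const_mul]
  refine mul_le_mul_of_nonneg_left ?_ two_pos.le
  refine setIntegral_mono_on (hint.const_mul _) (hφ.integrableOn_comp_two_mul ha hint)
    measurableSet_Ioc fun s hs => ?_
  have hs0 : 0 < s := hs.1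
  have hp := hφ.2.2.2.1 s hs0
  have hp2 := hφ.2.2.2.1 (2 * s) (by positivity)
  rw [← Real.mul_rpow (by positivity) (by positivity)]
  refine Real.rpow_le_rpow (by positivity) ?_ ha
  rw [div_mul_div_comm]
  exact div_le_div_of_nonneg_left (by positivity) hp2 (hdbl s hs0)

lemma two_mul_div_rpow_rpow {K m : ℝ} (hK : 0 < K) (hm : 1 < m) :
    (2 * (2 / K) ^ (1 / (m - 1))) ^ ((m - 1) / m) = 2 * K ^ (-1 / m) := by
  have hm0 : m ≠ 0 := by positivity
  have hm1 : m - 1 ≠ 0 := (sub_pos.2 hm).ne'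
  have e : 1 / (m - 1) * ((m - 1) / m) = 1 / m := by field_simp
  have e2 : (m - 1) / m + 1 / m = 1 := by field_simp; ring
  rw [Real.mul_rpow two_pos.le (by positivity), ← Real.rpow_mul (by positivity), e,
    Real.div_rpow two_pos.le hK.le, neg_div, Real.rpow_neg hK.le, ← mul_div_assoc,
    ← Real.rpow_add two_pos, e2, Real.rpow_one, div_eq_mul_inv]

lemma IsYoung.integral_nonneg {φ : ℝ → ℝ} (hφ : IsYoung φ) (a t : ℝ) :
    0 ≤ ∫ τ in Ioc (0 : ℝ) t, (τ / φ τ) ^ a :=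
  setIntegral_nonneg measurableSet_Ioc fun s hs =>
    Real.rpow_nonneg (div_nonneg hs.1.le (hφ.2.2.2.1 s hs.1).le) _

/-- `H(2t) ≥ 2 K^{-1/n} H(t)` for all `t ≥ 0`. -/
theorem statement8 (n : ℕ) (hn : 2 ≤ n) (φ : ℝ → ℝ) (hφ : IsYoung φ)
    (K : ℝ) (hdbl : ∀ t > 0, φ (2 * t) ≤ K * φ t) (hK : K < 2 ^ n) :
    ∀ t ≥ 0, 2 * K ^ (-(1:ℝ) / (n:ℝ)) * Hfun n φ t ≤ Hfun n φ (2 * t) := by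
  intro t ht
  have hm : (1 : ℝ) < n := by exact_mod_cast hn
  have hm1 : (0 : ℝ) < n - 1 := sub_pos.2 hm
  have hK0 := hφ.doubling_pos hdbl
  have hI := hφ.integral_nonneg (1 / ((n : ℝ) - 1))
  have hexp : 0 < ((n : ℝ) - 1) / n := by positivity
  unfold Hfun
  by_cases hint : IntegrableOn (fun τ => (τ / φ τ) ^ ((1 : ℝ) / ((n : ℝ) - 1))) (Ioc 0 t)
  · rw [← two_mul_div_rpow_rpow hK0 hm, ← Real.mul_rpow (by positivity) (hI t)]
    exact Real.rpow_le_rpow (mul_nonneg (by positivity) (hI t))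
      (hφ.integral_doubling (by positivity) ht hdbl hint) hexp.le
  · rw [integral_undef hint, Real.zero_rpow hexp.ne', mul_zero]
    exact Real.rpow_nonneg (hI (2 * t)) _
end
end

section
/- Let n ≥ 2 and let φ be a Young function satisfying the doubling condition with constant K_φ < 2^n. Then for every x ≥ 0, H(2^n x) ≤ 2^{n−1} H(x), where H(t) := (∫₀^t (τ/φ(τ))^{1/(n−1)} dτ)^{(n−1)/n}. -/
open MeasureTheory Metric Set Filter

noncomputable section

/-- For a Young function the quotient `t / φ t` is nonincreasing on `(0,∞)`. -/
theorem IsYoung.antitoneOn_div {φ : ℝ → ℝ} (hφ : IsYoung φ) :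
    AntitoneOn (fun t => t / φ t) (Ioi 0) := by
  obtain ⟨-, hconv, h0, hpos, -⟩ := hφ
  intro s hs t ht hst
  simp only [mem_Ioi] at hs ht
  have h := hconv.2 (mem_Ici.2 le_rfl) (mem_Ici.2 ht.le)
    (sub_nonneg.2 ((div_le_one ht).2 hst)) (div_pos hs ht).le (sub_add_cancel 1 (s / t))
  simp only [smul_eq_mul, mul_zero, zero_add, h0, div_mul_cancel₀ s ht.ne'] at h
  change t / φ t ≤ s / φ s
  rw [div_le_div_iff₀ (hpos t ht) (hpos s hs)]
  calc t * φ s ≤ t * (s / t * φ t) := by gcongr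
    _ = s * φ t := by field_simp

/-- Dilating the domain of integration of a nonnegative nonincreasing function by `c ≥ 1`
increases its integral by a factor of at most `c`. Integrability is not required: if the integral
over `(0, x]` diverges, both sides are `0` by convention. -/
theorem AntitoneOn.setIntegral_Ioc_mul_le {g : ℝ → ℝ} (hg : AntitoneOn g (Ioi 0))
    (hg0 : ∀ t > 0, 0 ≤ g t) {c x : ℝ} (hc : 1 ≤ c) (hx : 0 ≤ x) :
    ∫ t in Ioc 0 (c * x), g t ≤ c * ∫ t in Ioc 0 x, g t := by
  have hc0 : 0 < c := by linarith
  by_cases hint : IntegrableOn g (Ioc 0 x)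
  · have hsub : ∫ t in Ioc 0 (c * x), g t = c * ∫ t in Ioc 0 x, g (c * t) := by
      have h := intervalIntegral.integral_comp_mul_left (a := 0) (b := x) g hc0.ne'
      rw [mul_zero, intervalIntegral.integral_of_le hx,
        intervalIntegral.integral_of_le (by positivity), smul_eq_mul] at h
      rw [h, mul_inv_cancel_left₀ hc0.ne']
    rw [hsub]
    refine mul_le_mul_of_nonneg_left (integral_mono_of_nonneg ?_ hint ?_) hc0.le
    · filter_upwards [ae_restrict_mem measurableSet_Ioc] with t ht
      exact hg0 _ (mul_pos hc0 ht.1)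
    · filter_upwards [ae_restrict_mem measurableSet_Ioc] with t ht
      exact hg ht.1 (mul_pos hc0 ht.1) (le_mul_of_one_le_left ht.1.le hc)
  · have hint' : ¬ IntegrableOn g (Ioc 0 (c * x)) := fun h =>
      hint (h.mono_set (Ioc_subset_Ioc_right (le_mul_of_one_le_left hx hc)))
    rw [integral_undef hint, integral_undef hint', mul_zero]

/-- `H(2ⁿ x) ≤ 2^{n-1} H(x)` for all `x ≥ 0`. -/
theorem statement9 (n : ℕ) (hn : 2 ≤ n) (φ : ℝ → ℝ) (hφ : IsYoung φ)
    (K : ℝ) (hdbl : ∀ t > 0, φ (2 * t) ≤ K * φ t) (hK : K < 2 ^ n) :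
    ∀ x ≥ 0, Hfun n φ ((2:ℝ) ^ n * x) ≤ (2:ℝ) ^ (n - 1) * Hfun n φ x := by
  intro x hx
  have hn' : (2 : ℝ) ≤ n := by exact_mod_cast hn
  have hpow : 0 ≤ (1 : ℝ) / ((n : ℝ) - 1) := div_nonneg zero_le_one (by linarith)
  have hq : ∀ t > 0, 0 ≤ t / φ t := fun t ht => (div_pos ht (hφ.2.2.2.1 t ht)).le
  have hg0 : ∀ t > 0, 0 ≤ (t / φ t) ^ ((1 : ℝ) / ((n : ℝ) - 1)) :=
    fun t ht => Real.rpow_nonneg (hq t ht) _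
  have hg : AntitoneOn (fun t => (t / φ t) ^ ((1 : ℝ) / ((n : ℝ) - 1))) (Ioi 0) :=
    fun s hs t ht hst => Real.rpow_le_rpow (hq t ht) (hφ.antitoneOn_div hs ht hst) hpow
  have hnonneg : ∀ y, 0 ≤ ∫ t in Ioc 0 y, (t / φ t) ^ ((1 : ℝ) / ((n : ℝ) - 1)) :=
    fun y => setIntegral_nonneg measurableSet_Ioc fun t ht => hg0 t ht.1
  have hfac : ((2 : ℝ) ^ n) ^ (((n : ℝ) - 1) / n) = 2 ^ (n - 1) := by
    rw [← Real.rpow_natCast, ← Real.rpow_mul zero_le_two, mul_div_cancel₀ _ (by linarith),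
      ← Real.rpow_natCast, Nat.cast_sub (by lia), Nat.cast_one]
  rw [Hfun, Hfun, ← hfac, ← Real.mul_rpow (by positivity) (hnonneg x)]
  exact Real.rpow_le_rpow (hnonneg _)
    (hg.setIntegral_Ioc_mul_le hg0 (one_le_pow₀ one_le_two) hx)
    (div_nonneg (by linarith) (by linarith))
end
end
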